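/- Let ω = (ω₁, ω₂) : ℝ² → ℝ² be a Schwartz vector field with ∇·ω = 0, and let ω̃ := ∂₁ω₂ - ∂₂ω₁ be its (scalar) curl. Then for each i ∈ {1,2}: ∫_{ℝ²} ξ_i (ω(ξ)·∇ω̃(ξ)) dξ = 0 and ∫_{ℝ²} ξ_i (ω(ξ)·∇Δω̃(ξ)) dξ = 0. -/

import Mathlib

open MeasureTheory Real ENNReal

noncomputable section

abbrev E2 := EuclideanSpace ℝ (Fin 2)

def e (i : Fin 2) : E2 := EuclideanSpace.single i 1

/-- Partial derivative in the `i`-th coordinate direction. -/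
def pd (i : Fin 2) (f : E2 → ℝ) (x : E2) : ℝ := fderiv ℝ f x (e i)

/-- The Laplacian on `ℝ²`. -/
def lap (f : E2 → ℝ) (x : E2) : ℝ := ∑ i : Fin 2, pd i (pd i f) x

/-- The scalar curl `ω̃ = ∂₁ω₂ - ∂₂ω₁` of a vector field `ω = (ω₁, ω₂)`. -/
def scurl (ω₁ ω₂ : E2 → ℝ) (ξ : E2) : ℝ := pd 0 ω₂ ξ - pd 1 ω₁ ξ

open scoped LineDeriv SchwartzMap

def DD (i : Fin 2) : 𝓢(E2, ℝ) →ₗ[ℝ] 𝓢(E2, ℝ) :=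
  (LineDeriv.lineDerivOpCLM ℝ 𝓢(E2, ℝ) (e i)).toLinearMap

lemma DD_apply (i : Fin 2) (f : 𝓢(E2, ℝ)) (x : E2) : DD i f x = pd i f x := rfl

lemma DD_coe (i : Fin 2) (f : 𝓢(E2, ℝ)) : (DD i f : E2 → ℝ) = pd i f := rfl

lemma DD_comm (i j : Fin 2) (f : 𝓢(E2, ℝ)) : DD i (DD j f) = DD j (DD i f) := by
  ext x
  have hs : IsSymmSndFDerivAt ℝ (f : E2 → ℝ) x :=
    (f.smooth 2).contDiffAt.isSymmSndFDerivAt (by simp)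
  have hd : DifferentiableAt ℝ (fderiv ℝ (f : E2 → ℝ)) x :=
    ((f.smooth 2).fderiv_right (m := 1) (by norm_num)).differentiable (by simp) x
  have key : ∀ i j : Fin 2, DD i (DD j f) x = fderiv ℝ (fderiv ℝ (f : E2 → ℝ)) x (e i) (e j) := by
    intro i j
    rw [DD_apply, DD_coe]
    unfold pd
    rw [fderiv_clm_apply hd (by fun_prop)]
    simp
  rw [key, key]
  exact hs _ _

/-- multiplication by a coordinate -/
def XX (i : Fin 2) : 𝓢(E2, ℝ) →ₗ[ℝ] 𝓢(E2, ℝ) :=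
  (SchwartzMap.smulLeftCLM ℝ (fun x : E2 => x i)).toLinearMap

lemma XX_apply (i : Fin 2) (f : 𝓢(E2, ℝ)) (x : E2) : XX i f x = x i * f x := by
  have h : (fun x : E2 => x i).HasTemperateGrowth :=
    (EuclideanSpace.proj (𝕜 := ℝ) i).hasTemperateGrowth
  exact SchwartzMap.smulLeftCLM_apply_apply h f x

lemma DX (i j : Fin 2) (f : 𝓢(E2, ℝ)) :
    DD j (XX i f) = (if i = j then (1 : ℝ) else 0) • f + XX i (DD j f) := by
  ext x
  have h : (XX i f : E2 → ℝ) = fun y => EuclideanSpace.proj (𝕜 := ℝ) i y * f y := by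
    ext y; exact XX_apply i f y
  rw [DD_apply]
  unfold pd
  rw [h, fderiv_fun_mul (by fun_prop) f.differentiableAt]
  simp only [ContinuousLinearMap.fderiv]
  simp [XX_apply, DD_apply, pd, e]
  split_ifs <;> (try simp) <;> ring

def BB (f g : 𝓢(E2, ℝ)) : ℝ := ∫ x, f x * g x

lemma int_mul (f g : 𝓢(E2, ℝ)) : Integrable (fun x => f x * g x) :=
  (SchwartzMap.pairing (ContinuousLinearMap.mul ℝ ℝ) f g).integrable

lemma BB_comm (f g : 𝓢(E2, ℝ)) : BB f g = BB g f := by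
  unfold BB; simp_rw [mul_comm]

lemma BB_add (f g h : 𝓢(E2, ℝ)) : BB f (g + h) = BB f g + BB f h := by
  unfold BB
  rw [← integral_add (int_mul f g) (int_mul f h)]
  simp [mul_add]

lemma BB_smul (c : ℝ) (f g : 𝓢(E2, ℝ)) : BB f (c • g) = c * BB f g := by
  unfold BB
  rw [← integral_const_mul]
  congr 1; ext x; simp; ring

lemma BB_neg (f g : 𝓢(E2, ℝ)) : BB f (-g) = - BB f g := by
  have := BB_smul (-1) f g
  simpa using this

lemma BB_sub (f g h : 𝓢(E2, ℝ)) : BB f (g - h) = BB f g - BB f h := by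
  rw [sub_eq_add_neg, BB_add, BB_neg, sub_eq_add_neg]

lemma BB_D (i : Fin 2) (f g : 𝓢(E2, ℝ)) : BB f (DD i g) = - BB (DD i f) g :=
  SchwartzMap.integral_mul_lineDerivOp_right_eq_neg_left f g (e i)

lemma core (T : 𝓢(E2, ℝ) →ₗ[ℝ] 𝓢(E2, ℝ)) (hT : ∀ f g, BB f (T g) = BB (T f) g)
    (hc : ∀ i f, DD i (T f) = T (DD i f)) (a b : 𝓢(E2, ℝ)) (hdiv : DD 0 a + DD 1 b = 0)
    (i : Fin 2) :
    ∫ ξ, ξ i * (a ξ * DD 0 (T (DD 0 b - DD 1 a)) ξ + b ξ * DD 1 (T (DD 0 b - DD 1 a)) ξ) = 0 := by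
  have anti : ∀ i f, BB f (T (DD i f)) = 0 := by
    intro i f
    have h1 := hT f (DD i f)
    rw [BB_D, hc, BB_comm (T _)] at h1
    linarith
  have h0 : DD 0 a = - DD 1 b := eq_neg_of_add_eq_zero_left hdiv
  have h1 : DD 1 b = - DD 0 a := eq_neg_of_add_eq_zero_right hdiv
  have ha : BB a (T (DD 0 b - DD 1 a)) = 0 := by
    rw [map_sub, BB_sub, anti, ← hc, BB_D, h0, BB_comm, BB_neg, BB_comm, hT, BB_comm, anti]
    simp
  have hb : BB b (T (DD 0 b - DD 1 a)) = 0 := by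
    rw [map_sub, BB_sub, anti, ← hc, BB_D, h1, BB_comm, BB_neg, BB_comm, hT, BB_comm, anti]
    simp
  generalize T (DD 0 b - DD 1 a) = w at *
  have e1 : ∫ ξ, ξ i * (a ξ * DD 0 w ξ + b ξ * DD 1 w ξ)
      = BB (XX i a) (DD 0 w) + BB (XX i b) (DD 1 w) := by
    unfold BB
    rw [← integral_add (int_mul _ _) (int_mul _ _)]
    congr 1; ext x; rw [XX_apply, XX_apply]; ring
  rw [e1, BB_D, BB_D, DX, DX, BB_comm, BB_comm _ w, BB_add, BB_add, BB_smul, BB_smul, h1,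
    map_neg, BB_neg, BB_comm w a, BB_comm w b, ha, hb]
  ring

def LL : 𝓢(E2, ℝ) →ₗ[ℝ] 𝓢(E2, ℝ) := DD 0 ∘ₗ DD 0 + DD 1 ∘ₗ DD 1

lemma LL_apply (f : 𝓢(E2, ℝ)) : LL f = DD 0 (DD 0 f) + DD 1 (DD 1 f) := rfl

lemma LL_coe (f : 𝓢(E2, ℝ)) : (LL f : E2 → ℝ) = lap f := by
  ext x
  simp only [lap, Fin.sum_univ_two]
  rfl

lemma curl_coe (a b : 𝓢(E2, ℝ)) : ((DD 0 b - DD 1 a : 𝓢(E2, ℝ)) : E2 → ℝ) = scurl a b := rfl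

/-- For a divergence-free Schwartz vector field `ω` with scalar curl `ω̃`, the weighted
integrals `∫ ξ_i (ω·∇ω̃)` and `∫ ξ_i (ω·∇Δω̃)` both vanish. -/
theorem moments_of_transport_terms_vanish (ω₁ ω₂ : SchwartzMap E2 ℝ)
    (hdiv : ∀ ξ : E2, pd 0 (⇑ω₁) ξ + pd 1 (⇑ω₂) ξ = 0) (i : Fin 2) :
    (∫ ξ, ξ i * (ω₁ ξ * pd 0 (scurl (⇑ω₁) (⇑ω₂)) ξ + ω₂ ξ * pd 1 (scurl (⇑ω₁) (⇑ω₂)) ξ) = 0) ∧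
    (∫ ξ, ξ i * (ω₁ ξ * pd 0 (lap (scurl (⇑ω₁) (⇑ω₂))) ξ
        + ω₂ ξ * pd 1 (lap (scurl (⇑ω₁) (⇑ω₂))) ξ) = 0) := by
  have hd : DD 0 ω₁ + DD 1 ω₂ = 0 := by
    ext x; exact hdiv x
  constructor
  · have := core LinearMap.id (fun _ _ => rfl) (fun _ _ => rfl) ω₁ ω₂ hd i
    simpa only [LinearMap.id_apply, DD_apply, curl_coe] using this
  · have := core LL (fun f g => by
      rw [LL_apply, LL_apply, BB_add, BB_comm (_ + _), BB_add, BB_comm g, BB_comm g]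
      simp only [BB_D, neg_neg]) (fun i f => by
      rw [LL_apply, LL_apply, map_add, DD_comm i 0, DD_comm i 0, DD_comm i 1, DD_comm i 1])
      ω₁ ω₂ hd i
    simpa only [DD_apply, LL_coe, curl_coe] using this
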